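/- Let n ≥ 1. Let Γ ⊆ [0,1)ⁿ be a compact set with μH^{n−1}(Γ) < ∞, let Ω ⊆ ℝⁿ be open and bounded with Lebesgue-negligible topological boundary, and let ψ : ℝⁿ × ℝⁿ → ℝ be continuous, bounded, and ℤⁿ-periodic in its second argument. For ε > 0 set K_ε = {k ∈ ℤⁿ : ε•(k + [0,1]ⁿ) ⊆ Ω} and Γ_ε = ⋃_{k∈K_ε} ε•(k + Γ). Then ε · ∫_{Γ_ε} ψ(x, x/ε) dμH^{n−1}(x) converges, as ε → 0⁺, to ∫_Ω ∫_Γ ψ(x, y) dμH^{n−1}(y) dx, where the outer integral is with respect to Lebesgue measure on ℝⁿ. -/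

import Mathlib

open MeasureTheory Filter
open scoped Pointwise

lemma psal_cov (n : ℕ) (hn : 1 ≤ n) (Γ : Set (Fin n → ℝ)) (ε : ℝ) (hε : 0 < ε)
    (v : Fin n → ℝ) (f : (Fin n → ℝ) → ℝ) :
    ∫ x in ε • (v +ᵥ Γ), f x ∂(μH[(n : ℝ) - 1]) =
      ε ^ (n - 1) * ∫ y in Γ, f (ε • (v + y)) ∂(μH[(n : ℝ) - 1]) := by
  have hd : (0 : ℝ) ≤ (n : ℝ) - 1 := by
    have : (1 : ℝ) ≤ n := by exact_mod_cast hn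
    linarith
  let T : (Fin n → ℝ) ≃ₜ (Fin n → ℝ) := (Homeomorph.addLeft v).trans (Homeomorph.smulOfNeZero ε hε.ne')
  have hT : ∀ y, T y = ε • (v + y) := fun y => rfl
  have himg : ∀ s : Set (Fin n → ℝ), T '' s = ε • (v +ᵥ s) := by
    intro s
    ext x
    simp only [Set.mem_image, Set.mem_smul_set, Set.mem_vadd_set, hT, vadd_eq_add]
    constructor
    · rintro ⟨y, hy, rfl⟩
      exact ⟨_, ⟨y, hy, rfl⟩, rfl⟩
    · rintro ⟨_, ⟨y, hy, rfl⟩, rfl⟩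
      exact ⟨y, hy, rfl⟩
  have hmeas : ∀ s : Set (Fin n → ℝ), μH[(n : ℝ) - 1] (T '' s) =
      ENNReal.ofReal (ε ^ (n - 1)) * μH[(n : ℝ) - 1] s := by
    intro s
    rw [himg, Measure.hausdorffMeasure_smul₀ hd hε.ne',
      hausdorffMeasure_vadd v (Or.inl hd)]
    rw [ENNReal.smul_def, smul_eq_mul]
    congr 1
    have : (n : ℝ) - 1 = ((n - 1 : ℕ) : ℝ) := by push_cast [hn]; ring
    rw [this, NNReal.rpow_natCast, ENNReal.ofReal_pow hε.le, ENNReal.coe_pow]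
    congr 1
    rw [← Real.enorm_of_nonneg hε.le]
    rfl
  have hμ : (μH[(n : ℝ) - 1] : Measure (Fin n → ℝ)) =
      ENNReal.ofReal (ε ^ (n - 1)) • Measure.map T μH[(n : ℝ) - 1] := by
    ext s hs
    rw [Measure.smul_apply, Measure.map_apply T.continuous.measurable hs, smul_eq_mul, ← hmeas,
      Set.image_preimage_eq _ T.surjective]
  rw [← himg]
  conv_lhs => rw [hμ]
  rw [Measure.restrict_smul, integral_smul_measure,
    T.measurableEmbedding.setIntegral_map, Set.preimage_image_eq _ T.injective,
    ENNReal.toReal_ofReal (by positivity), smul_eq_mul]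
  rfl

lemma psal_flo {ε : ℝ} (hε : 0 < ε) (t : ℝ) (k : ℤ) :
    ⌊ε⁻¹ * t⌋ = k ↔ t ∈ Set.Ico (ε * k) (ε * k + ε) := by
  rw [Int.floor_eq_iff, Set.mem_Ico, ← div_eq_inv_mul, le_div_iff₀ hε, div_lt_iff₀ hε]
  constructor <;> rintro ⟨h1, h2⟩ <;> constructor <;> linarith

lemma psal_finite (n : ℕ) (Ω : Set (Fin n → ℝ)) (hΩb : Bornology.IsBounded Ω)
    (ε : ℝ) (hε : 0 < ε) :
    {k : Fin n → ℤ |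
      ε • ((fun i => (k i : ℝ)) +ᵥ Set.Icc (0 : Fin n → ℝ) 1) ⊆ Ω}.Finite := by
  obtain ⟨R, hR⟩ := hΩb.exists_norm_le
  refine (Set.finite_Icc (fun _ : Fin n => -⌈R / ε⌉) (fun _ => ⌈R / ε⌉)).subset ?_
  intro k hk
  have h0 : ε • (fun i => (k i : ℝ)) ∈ Ω := by
    apply hk
    refine ⟨_, ⟨0, ⟨le_refl _, zero_le_one⟩, rfl⟩, ?_⟩
    simp
  have key : ∀ i, |(k i : ℝ)| ≤ R / ε := by
    intro i
    have h1 := (norm_le_pi_norm _ i).trans (hR _ h0)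
    simp only [Pi.smul_apply, smul_eq_mul, norm_mul, Real.norm_eq_abs, abs_of_pos hε] at h1
    rw [le_div_iff₀ hε]
    linarith
  constructor
  · intro i
    have := (abs_le.1 ((key i).trans (Int.le_ceil _))).1
    exact_mod_cast this
  · intro i
    have := (abs_le.1 ((key i).trans (Int.le_ceil _))).2
    exact_mod_cast this

open scoped Classical in
lemma psal_eq (n : ℕ) (hn : 1 ≤ n)
    (Γ : Set (Fin n → ℝ)) (hΓc : IsCompact Γ)
    (hΓsub : Γ ⊆ {y : Fin n → ℝ | ∀ i, y i ∈ Set.Ico (0 : ℝ) 1})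
    (hΓfin : μH[(n : ℝ) - 1] Γ < ⊤)
    (Ω : Set (Fin n → ℝ)) (hΩo : IsOpen Ω) (hΩb : Bornology.IsBounded Ω)
    (ψ : (Fin n → ℝ) → (Fin n → ℝ) → ℝ)
    (hψc : Continuous fun p : (Fin n → ℝ) × (Fin n → ℝ) => ψ p.1 p.2)
    (hψb : ∃ C : ℝ, ∀ x y, |ψ x y| ≤ C)
    (hψper : ∀ (x y : Fin n → ℝ) (k : Fin n → ℤ),
      ψ x (y + fun i => (k i : ℝ)) = ψ x y) (ε : ℝ) (hε : 0 < ε) :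
    (ε * ∫ x in
          ⋃ k ∈ {k : Fin n → ℤ |
              ε • ((fun i => (k i : ℝ)) +ᵥ Set.Icc (0 : Fin n → ℝ) 1) ⊆ Ω},
            ε • ((fun i => (k i : ℝ)) +ᵥ Γ),
          ψ x (ε⁻¹ • x) ∂(μH[(n : ℝ) - 1])) =
    ∫ x in Ω, if ε • ((fun i => (⌊ε⁻¹ * x i⌋ : ℝ)) +ᵥ Set.Icc (0 : Fin n → ℝ) 1) ⊆ Ω then
      ∫ y in Γ, ψ (ε • ((fun i => (⌊ε⁻¹ * x i⌋ : ℝ)) + y)) y ∂(μH[(n : ℝ) - 1]) else 0 := by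
  obtain ⟨C, hC⟩ := hψb
  set K : Finset (Fin n → ℤ) := (psal_finite n Ω hΩb ε hε).toFinset with hK
  have hKm : ∀ k, k ∈ K ↔
      ε • ((fun i => (k i : ℝ)) +ᵥ Set.Icc (0 : Fin n → ℝ) 1) ⊆ Ω := by
    intro k; simp [hK]
  let cell : (Fin n → ℤ) → Set (Fin n → ℝ) := fun k =>
    Set.pi Set.univ fun i => Set.Ico (ε * (k i : ℝ)) (ε * (k i : ℝ) + ε)
  have hcell : ∀ k x, x ∈ cell k ↔ (fun i => ⌊ε⁻¹ * x i⌋) = k := by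
    intro k x
    simp only [cell, Set.mem_univ_pi, funext_iff, psal_flo hε]
  have hsubcell : ∀ k, ε • ((fun i => (k i : ℝ)) +ᵥ Γ) ⊆ cell k := by
    rintro k _ ⟨_, ⟨y, hy, rfl⟩, rfl⟩
    simp only [cell, Set.mem_univ_pi]
    intro i
    obtain ⟨h1, h2⟩ := hΓsub hy i
    simp only [Pi.smul_apply, vadd_eq_add, Pi.add_apply, smul_eq_mul, Set.mem_Ico]
    constructor <;> nlinarith
  have hdisj : ∀ k l, k ≠ l → Disjoint (cell k) (cell l) := by
    intro k l hkl
    rw [Set.disjoint_left]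
    intro x h1 h2
    rw [hcell] at h1 h2
    exact hkl (h1.symm.trans h2)
  have hcellm : ∀ k, MeasurableSet (cell k) := fun k =>
    MeasurableSet.univ_pi fun i => measurableSet_Ico
  have hcellΩ : ∀ k ∈ K, cell k ⊆ Ω := by
    intro k hk x hx
    rw [hKm] at hk
    apply hk
    refine ⟨ε⁻¹ • x, ⟨ε⁻¹ • x - (fun i => (k i : ℝ)), ⟨?_, ?_⟩, by simp⟩, by simp [hε.ne']⟩
    all_goals
      intro i
      have := (Set.mem_univ_pi.1 hx) i
      rw [← psal_flo hε, Int.floor_eq_iff] at this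
      simp only [Pi.zero_apply, Pi.one_apply, Pi.sub_apply, Pi.smul_apply, smul_eq_mul]
      linarith
  have hvol : ∀ k, (volume (cell k)).toReal = ε ^ n := by
    intro k
    rw [Real.volume_pi_Ico_toReal]
    · simp
    · intro i
      simp [hε.le]
  have hU : (⋃ k ∈ {k : Fin n → ℤ |
              ε • ((fun i => (k i : ℝ)) +ᵥ Set.Icc (0 : Fin n → ℝ) 1) ⊆ Ω},
            ε • ((fun i => (k i : ℝ)) +ᵥ Γ)) = ⋃ k ∈ K, ε • ((fun i => (k i : ℝ)) +ᵥ Γ) := by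
    simp only [hKm, Set.mem_ofPred_eq]
  have hcomp : ∀ k : Fin n → ℤ, IsCompact (ε • ((fun i => (k i : ℝ)) +ᵥ Γ)) := by
    intro k
    exact (hΓc.vadd _).smul ε
  have hd : (0 : ℝ) ≤ (n : ℝ) - 1 := by
    have : (1 : ℝ) ≤ n := by exact_mod_cast hn
    linarith
  have hfin : ∀ k : Fin n → ℤ, μH[(n : ℝ) - 1] (ε • ((fun i => (k i : ℝ)) +ᵥ Γ)) < ⊤ := by
    intro k
    rw [Measure.hausdorffMeasure_smul₀ hd hε.ne', hausdorffMeasure_vadd _ (Or.inl hd),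
      ENNReal.smul_def, smul_eq_mul]
    exact ENNReal.mul_lt_top ENNReal.coe_lt_top hΓfin
  have hcont : Continuous fun x : Fin n → ℝ => ψ x (ε⁻¹ • x) :=
    hψc.comp (continuous_id.prodMk (continuous_const_smul ε⁻¹))
  rw [hU, integral_biUnion_finset]
  rotate_left
  · intro k _
    exact (hcomp k).measurableSet
  · intro k _ l _ hkl
    exact (hdisj k l hkl).mono (hsubcell k) (hsubcell l)
  · intro k _
    exact Measure.integrableOn_of_bounded (M := C) (hfin k).ne hcont.aestronglyMeasurable
      (Eventually.of_forall fun x => hC _ _)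
  set h : (Fin n → ℝ) → ℝ := fun x =>
    if ε • ((fun i => (⌊ε⁻¹ * x i⌋ : ℝ)) +ᵥ Set.Icc (0 : Fin n → ℝ) 1) ⊆ Ω then
      ∫ y in Γ, ψ (ε • ((fun i => (⌊ε⁻¹ * x i⌋ : ℝ)) + y)) y ∂(μH[(n : ℝ) - 1]) else 0 with hh
  have hconst : ∀ k ∈ K, ∀ x ∈ cell k, h x =
      ∫ y in Γ, ψ (ε • ((fun i => (k i : ℝ)) + y)) y ∂(μH[(n : ℝ) - 1]) := by
    intro k hk x hx
    rw [hcell] at hx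
    subst hx
    rw [hKm] at hk
    exact if_pos hk
  have hsub : (⋃ k ∈ K, cell k) ⊆ Ω := Set.iUnion₂_subset hcellΩ
  have hR : ∫ x in Ω, h x = ∫ x in ⋃ k ∈ K, cell k, h x := by
    refine setIntegral_eq_of_subset_of_forall_sdiff_eq_zero hΩo.measurableSet hsub ?_
    rintro x ⟨_, hx⟩
    simp only [hh]
    rw [if_neg]
    intro hc
    refine hx ?_
    simp only [Set.mem_iUnion]
    exact ⟨fun i => ⌊ε⁻¹ * x i⌋, (hKm _).2 hc, (hcell _ _).2 rfl⟩
  rw [hR, integral_biUnion_finset]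
  rotate_left
  · intro k _
    exact hcellm k
  · intro k _ l _ hkl
    exact hdisj k l hkl
  · intro k hk
    rw [integrableOn_congr_fun (hconst k hk) (hcellm k)]
    refine integrableOn_const ?_
    exact ((measure_mono (hcellΩ k hk)).trans_lt hΩb.measure_lt_top).ne
  rw [Finset.mul_sum]
  refine Finset.sum_congr rfl fun k hk => ?_
  rw [setIntegral_congr_fun (hcellm k) (hconst k hk), setIntegral_const, psal_cov n hn Γ ε hε,
    smul_eq_mul, measureReal_def, hvol, ← mul_assoc, ← pow_succ', Nat.sub_add_cancel hn]
  congr 1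
  refine integral_congr_ae (Eventually.of_forall fun y => ?_)
  simp only [inv_smul_smul₀ hε.ne']
  rw [add_comm (fun i => (k i : ℝ)) y, hψper]

/-- Periodic surface averaging: for Γ ⊆ [0,1)ⁿ compact with finite
(n−1)-dimensional Hausdorff measure, Ω open bounded with Lebesgue-negligible boundary,
and ψ continuous, bounded and ℤⁿ-periodic in its second argument,
ε ∫_{Γ_ε} ψ(x, x/ε) dμH^{n−1}(x) → ∫_Ω ∫_Γ ψ(x,y) dμH^{n−1}(y) dx as ε → 0⁺,
where Γ_ε = ⋃_{k ∈ K_ε} ε•(k+Γ) and K_ε = {k ∈ ℤⁿ : ε•(k+[0,1]ⁿ) ⊆ Ω}. -/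
theorem periodic_surface_average_limit (n : ℕ) (hn : 1 ≤ n)
    (Γ : Set (Fin n → ℝ)) (hΓc : IsCompact Γ)
    (hΓsub : Γ ⊆ {y : Fin n → ℝ | ∀ i, y i ∈ Set.Ico (0 : ℝ) 1})
    (hΓfin : μH[(n : ℝ) - 1] Γ < ⊤)
    (Ω : Set (Fin n → ℝ)) (hΩo : IsOpen Ω) (hΩb : Bornology.IsBounded Ω)
    (hΩfr : volume (frontier Ω) = 0)
    (ψ : (Fin n → ℝ) → (Fin n → ℝ) → ℝ)
    (hψc : Continuous fun p : (Fin n → ℝ) × (Fin n → ℝ) => ψ p.1 p.2)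
    (hψb : ∃ C : ℝ, ∀ x y, |ψ x y| ≤ C)
    (hψper : ∀ (x y : Fin n → ℝ) (k : Fin n → ℤ),
      ψ x (y + fun i => (k i : ℝ)) = ψ x y) :
    Tendsto
      (fun ε : ℝ =>
        ε * ∫ x in
          ⋃ k ∈ {k : Fin n → ℤ |
              ε • ((fun i => (k i : ℝ)) +ᵥ Set.Icc (0 : Fin n → ℝ) 1) ⊆ Ω},
            ε • ((fun i => (k i : ℝ)) +ᵥ Γ),
          ψ x (ε⁻¹ • x) ∂(μH[(n : ℝ) - 1]))
      (nhdsWithin 0 (Set.Ioi 0))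
      (nhds (∫ x in Ω, ∫ y in Γ, ψ x y ∂(μH[(n : ℝ) - 1]))) := by
  classical
  have hψb' := hψb
  obtain ⟨C, hC⟩ := hψb'
  have hC0 : 0 ≤ C := (abs_nonneg _).trans (hC 0 0)
  haveI : IsFiniteMeasure ((μH[(n : ℝ) - 1] : Measure (Fin n → ℝ)).restrict Γ) :=
    ⟨by rwa [Measure.restrict_apply_univ]⟩
  haveI : IsFiniteMeasure ((volume : Measure (Fin n → ℝ)).restrict Ω) :=
    ⟨by rw [Measure.restrict_apply_univ]; exact hΩb.measure_lt_top⟩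
  -- closeness estimate
  have hclose : ∀ ε : ℝ, 0 < ε → ∀ x y : Fin n → ℝ, y ∈ Set.Icc (0 : Fin n → ℝ) 1 →
      dist (ε • ((fun i => (⌊ε⁻¹ * x i⌋ : ℝ)) + y)) x ≤ ε := by
    intro ε hε x y hy
    rw [dist_pi_le_iff hε.le]
    intro i
    have h1 := Int.floor_le (ε⁻¹ * x i)
    have h2 := Int.lt_floor_add_one (ε⁻¹ * x i)
    have h3 : 0 ≤ y i := hy.1 i
    have h4 : y i ≤ 1 := hy.2 i
    have h5 : ε * (ε⁻¹ * x i) = x i := by field_simp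
    simp only [Pi.smul_apply, Pi.add_apply, smul_eq_mul]
    rw [Real.dist_eq, abs_le]
    constructor <;> nlinarith
  have hΓIcc : ∀ y ∈ Γ, y ∈ Set.Icc (0 : Fin n → ℝ) 1 := fun y hy =>
    ⟨fun i => (hΓsub hy i).1, fun i => (hΓsub hy i).2.le⟩
  have hεt : Tendsto (fun ε : ℝ => ε) (nhdsWithin 0 (Set.Ioi 0)) (nhds 0) :=
    tendsto_nhdsWithin_of_tendsto_nhds tendsto_id
  have hpos : ∀ᶠ ε : ℝ in nhdsWithin 0 (Set.Ioi 0), 0 < ε := self_mem_nhdsWithin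
  refine Tendsto.congr' (hpos.mono fun ε hε => (psal_eq n hn Γ hΓc hΓsub hΓfin Ω hΩo hΩb ψ hψc
    hψb hψper ε hε).symm) ?_
  refine tendsto_integral_filter_of_dominated_convergence
    (fun _ => C * (((μH[(n : ℝ) - 1] : Measure (Fin n → ℝ)).restrict Γ).real Set.univ))
    ?_ ?_ (integrable_const _) ?_
  · refine Eventually.of_forall fun ε => ?_
    let G : (Fin n → ℤ) → ℝ := fun k =>
      if ε • ((fun i => (k i : ℝ)) +ᵥ Set.Icc (0 : Fin n → ℝ) 1) ⊆ Ω then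
      ∫ y in Γ, ψ (ε • ((fun i => (k i : ℝ)) + y)) y ∂(μH[(n : ℝ) - 1]) else 0
    have hG : Measurable G := measurable_of_countable G
    have hf : Measurable fun x : Fin n → ℝ => (fun i => ⌊ε⁻¹ * x i⌋ : Fin n → ℤ) := by
      refine measurable_pi_lambda _ fun i => ?_
      exact Int.measurable_floor.comp ((measurable_pi_apply i).const_mul _)
    exact (hG.comp hf).aestronglyMeasurable
  · refine Eventually.of_forall fun ε => Eventually.of_forall fun x => ?_
    split_ifs
    · exact norm_integral_le_of_norm_le_const (Eventually.of_forall fun y => hC _ _)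
    · rw [norm_zero]
      positivity
  · refine (ae_restrict_mem hΩo.measurableSet).mono fun x hx => ?_
    obtain ⟨δ, hδ, hball⟩ := Metric.isOpen_iff.1 hΩo x hx
    have hsmall : ∀ᶠ ε : ℝ in nhdsWithin 0 (Set.Ioi 0), ε < δ := hεt.eventually (gt_mem_nhds hδ)
    have key : Tendsto (fun ε : ℝ =>
        ∫ y in Γ, ψ (ε • ((fun i => (⌊ε⁻¹ * x i⌋ : ℝ)) + y)) y ∂(μH[(n : ℝ) - 1]))
        (nhdsWithin 0 (Set.Ioi 0)) (nhds (∫ y in Γ, ψ x y ∂(μH[(n : ℝ) - 1]))) := by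
      refine tendsto_integral_filter_of_dominated_convergence (fun _ => C) ?_ ?_
        (integrable_const _) ?_
      · refine Eventually.of_forall fun ε => Continuous.aestronglyMeasurable ?_
        exact hψc.comp ((by fun_prop : Continuous fun y : Fin n → ℝ =>
          ε • ((fun i => (⌊ε⁻¹ * x i⌋ : ℝ)) + y)).prodMk continuous_id)
      · exact Eventually.of_forall fun ε => Eventually.of_forall fun y => hC _ _
      · refine (ae_restrict_mem hΓc.measurableSet).mono fun y hy => ?_
        have hx' : Tendsto (fun ε : ℝ => ε • ((fun i => (⌊ε⁻¹ * x i⌋ : ℝ)) + y))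
            (nhdsWithin 0 (Set.Ioi 0)) (nhds x) := by
          rw [tendsto_iff_dist_tendsto_zero]
          exact squeeze_zero' (Eventually.of_forall fun _ => dist_nonneg)
            (hpos.mono fun ε hε => hclose ε hε x y (hΓIcc y hy)) hεt
        exact (hψc.tendsto (x, y)).comp (hx'.prodMk_nhds tendsto_const_nhds)
    refine key.congr' ?_
    filter_upwards [hpos, hsmall] with ε hε hεδ
    rw [if_pos]
    rintro _ ⟨_, ⟨y, hy, rfl⟩, rfl⟩
    apply hball
    exact (hclose ε hε x y hy).trans_lt hεδ
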